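/- Let X_1,…,X_K be mutually independent finitely-valued random variables and let (X_1,…,X_K,Y,Z) be jointly distributed. Then the maximum of ∑_{k∈𝒦} R_k^s over all rate tuples (R_1^s,R_1^o,…,R_K^s,R_K^o) in the union ⋃_{𝒦′⊆𝒦} 𝓡(X_𝒦,𝒦′) is attained and equals R^s(X_𝒦) := max_{𝒦′⊆𝒦} [ I(X_{𝒦′};Y|X_{𝒦∖𝒦′}) − I(X_{𝒦′};Z|X_{𝒦∖𝒦′}) ]⁺. -/

import Mathlib

open scoped Classical

noncomputable section

/-- Probability that random variable `X` takes value `x`, under pmf `p` on a finite sample space. -/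
def probOf {Ω α : Type} [Fintype Ω] (p : Ω → ℝ) (X : Ω → α) (x : α) : ℝ :=
  ∑ ω, if X ω = x then p ω else 0

/-- Shannon entropy of a finitely-valued random variable. -/
def Hent {Ω α : Type} [Fintype Ω] [Fintype α] (p : Ω → ℝ) (X : Ω → α) : ℝ :=
  -∑ x, probOf p X x * Real.log (probOf p X x)

/-- Conditional entropy `H(X | C)`. -/
def condHent {Ω α γ : Type} [Fintype Ω] [Fintype α] [Fintype γ]
    (p : Ω → ℝ) (X : Ω → α) (C : Ω → γ) : ℝ :=
  Hent p (fun ω => (X ω, C ω)) - Hent p C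

/-- Conditional mutual information `I(A;B | C)`. -/
def IcondMut {Ω α β γ : Type} [Fintype Ω] [Fintype α] [Fintype β] [Fintype γ]
    (p : Ω → ℝ) (A : Ω → α) (B : Ω → β) (C : Ω → γ) : ℝ :=
  condHent p A C + condHent p B C - condHent p (fun ω => (A ω, B ω)) C

/-- Mutual information `I(A;B)`. -/
def Imut {Ω α β : Type} [Fintype Ω] [Fintype α] [Fintype β]
    (p : Ω → ℝ) (A : Ω → α) (B : Ω → β) : ℝ :=
  Hent p A + Hent p B - Hent p (fun ω => (A ω, B ω))

/-- `p` is a probability mass function. -/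
def IsPMF {Ω : Type} [Fintype Ω] (p : Ω → ℝ) : Prop :=
  (∀ ω, 0 ≤ p ω) ∧ ∑ ω, p ω = 1

/-- The tuple `X_S = (X_k)_{k ∈ S}` as a random variable. -/
def tup {Ω ι : Type} {𝒳 : ι → Type} (X : ∀ k, Ω → 𝒳 k) (S : Finset ι) :
    Ω → ∀ k : S, 𝒳 k.1 :=
  fun ω k => X k.1 ω

/-- The random variables `X_1, …, X_K` are mutually independent. -/
def MutIndep {Ω ι : Type} [Fintype Ω] [Fintype ι] {𝒳 : ι → Type} [∀ k, Fintype (𝒳 k)]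
    (p : Ω → ℝ) (X : ∀ k, Ω → 𝒳 k) : Prop :=
  ∀ x : ∀ k, 𝒳 k, probOf p (fun ω k => X k ω) x = ∏ k, probOf p (X k) (x k)

/-- The rate region `𝓡(X_𝒦, 𝒦′)`. -/
def InRegion {Ω : Type} [Fintype Ω] {K : ℕ} {𝒳 : Fin K → Type} [∀ k, Fintype (𝒳 k)]
    {𝒴 𝒵 : Type} [Fintype 𝒴] [Fintype 𝒵]
    (p : Ω → ℝ) (X : ∀ k, Ω → 𝒳 k) (Y : Ω → 𝒴) (Z : Ω → 𝒵)
    (K' : Finset (Fin K)) (Rs Ro : Fin K → ℝ) : Prop :=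
  (∀ k, 0 ≤ Rs k) ∧ (∀ k, 0 ≤ Ro k) ∧ (∀ k ∈ Finset.univ \ K', Rs k = 0) ∧
    ∀ S ⊆ K', ∀ S' ⊆ S, ∀ T ⊆ Finset.univ \ K',
      ∑ k ∈ S, Rs k + ∑ k ∈ S \ S', Ro k + ∑ k ∈ T, Ro k ≤
        max 0 (IcondMut p (tup X (S ∪ T)) Y (tup X (Finset.univ \ (S ∪ T))) -
               IcondMut p (tup X S') Z (tup X (Finset.univ \ K')))

section Entropy

variable {Ω : Type} [Fintype Ω]

theorem sum_probOf_mul {α : Type} [Fintype α] (p : Ω → ℝ) (X : Ω → α) (φ : α → ℝ) :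
    ∑ x, probOf p X x * φ x = ∑ ω, p ω * φ (X ω) := by
  simp only [probOf, Finset.sum_mul]
  rw [Finset.sum_comm]
  refine Finset.sum_congr rfl fun ω _ => ?_
  simp [ite_mul]

theorem Hent_eq {α : Type} [Fintype α] (p : Ω → ℝ) (X : Ω → α) :
    Hent p X = -∑ ω, p ω * Real.log (probOf p X (X ω)) := by
  rw [Hent, sum_probOf_mul p X fun x => Real.log (probOf p X x)]

/-- Entropy depends only on the partition of the sample space into fibres. -/
theorem Hent_congr {α β : Type} [Fintype α] [Fintype β] (p : Ω → ℝ) {X : Ω → α} {Y : Ω → β}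
    (h : ∀ ω ω', X ω = X ω' ↔ Y ω = Y ω') : Hent p X = Hent p Y := by
  simp only [Hent_eq, probOf, h]

theorem probOf_nonneg {α : Type} {p : Ω → ℝ} (hp : ∀ ω, 0 ≤ p ω) (X : Ω → α) (x : α) :
    0 ≤ probOf p X x :=
  Finset.sum_nonneg fun ω _ => by split_ifs <;> simp [hp ω]

theorem le_probOf {α : Type} {p : Ω → ℝ} (hp : ∀ ω, 0 ≤ p ω) (X : Ω → α) (ω : Ω) :
    p ω ≤ probOf p X (X ω) := by
  have := Finset.single_le_sum (f := fun ω' => if X ω' = X ω then p ω' else 0)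
    (fun ω' _ => by split_ifs <;> simp [hp ω']) (Finset.mem_univ ω)
  simpa [probOf] using this

theorem sum_probOf_pair {α γ : Type} [Fintype α] (p : Ω → ℝ) (A : Ω → α) (C : Ω → γ) (c : γ) :
    ∑ a, probOf p (fun ω => (A ω, C ω)) (a, c) = probOf p C c := by
  simp only [probOf]
  rw [Finset.sum_comm]
  refine Finset.sum_congr rfl fun ω _ => ?_
  by_cases h : C ω = c <;> simp [h]

theorem IcondMut_nonneg {α β γ : Type} [Fintype α] [Fintype β] [Fintype γ] {p : Ω → ℝ}
    (hp : IsPMF p) (A : Ω → α) (B : Ω → β) (C : Ω → γ) : 0 ≤ IcondMut p A B C := by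
  obtain ⟨hp0, hp1⟩ := hp
  set P := probOf p (fun ω => ((A ω, B ω), C ω)) with hP
  set PA := probOf p (fun ω => (A ω, C ω)) with hPA
  set PB := probOf p (fun ω => (B ω, C ω)) with hPB
  set PC := probOf p C with hPC
  set φ : (α × β) × γ → ℝ := fun x => PA (x.1.1, x.2) * PB (x.1.2, x.2) / PC x.2 with hφ
  have hφ0 (x) : 0 ≤ φ x := by
    have := probOf_nonneg hp0 (fun ω => (A ω, C ω)) (x.1.1, x.2)
    have := probOf_nonneg hp0 (fun ω => (B ω, C ω)) (x.1.2, x.2)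
    have := probOf_nonneg hp0 C x.2
    positivity
  have hsum : ∑ x, φ x = 1 := by
    rw [Fintype.sum_prod_type_right]
    have (c : γ) : ∑ ab : α × β, φ (ab, c) = PC c := by
      simp only [hφ, ← Finset.sum_div]
      rw [Fintype.sum_prod_type]
      simp only [← Finset.mul_sum, ← Finset.sum_mul, hPA, hPB, sum_probOf_pair]
      exact mul_self_div_self _
    simp only [this]
    have := sum_probOf_mul p C fun _ => 1
    simpa [hp1] using this
  have hle : ∑ ω, p ω * (φ ((A ω, B ω), C ω) / P ((A ω, B ω), C ω)) ≤ 1 := by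
    rw [← sum_probOf_mul p (fun ω => ((A ω, B ω), C ω)) fun x => φ x / P x, ← hsum]
    refine Finset.sum_le_sum fun x _ => ?_
    rcases eq_or_ne (P x) 0 with h | h
    · simp [h, hφ0 x]
    · rw [← hP, mul_div_cancel₀ _ h]
  have hterm (ω : Ω) : p ω * (Real.log (PA (A ω, C ω)) + Real.log (PB (B ω, C ω))
      - Real.log (P ((A ω, B ω), C ω)) - Real.log (PC (C ω)))
      ≤ p ω * (φ ((A ω, B ω), C ω) / P ((A ω, B ω), C ω)) - p ω := by
    rcases (hp0 ω).eq_or_lt with h | h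
    · simp [← h]
    have h1 : 0 < PA (A ω, C ω) := h.trans_le (le_probOf hp0 (fun ω => (A ω, C ω)) ω)
    have h2 : 0 < PB (B ω, C ω) := h.trans_le (le_probOf hp0 (fun ω => (B ω, C ω)) ω)
    have h3 : 0 < P ((A ω, B ω), C ω) :=
      h.trans_le (le_probOf hp0 (fun ω => ((A ω, B ω), C ω)) ω)
    have h4 : 0 < PC (C ω) := h.trans_le (le_probOf hp0 C ω)
    have := Real.log_le_sub_one_of_pos
      (x := PA (A ω, C ω) * PB (B ω, C ω) / PC (C ω) / P ((A ω, B ω), C ω)) (by positivity)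
    rw [Real.log_div (by positivity) h3.ne', Real.log_div (by positivity) h4.ne',
      Real.log_mul h1.ne' h2.ne'] at this
    calc _ ≤ p ω * (φ ((A ω, B ω), C ω) / P ((A ω, B ω), C ω) - 1) :=
          mul_le_mul_of_nonneg_left (by simp only [hφ]; linarith) h.le
      _ = _ := by ring
  have htot := Finset.sum_le_sum fun ω (_ : ω ∈ Finset.univ) => hterm ω
  simp only [mul_sub, mul_add, Finset.sum_sub_distrib, Finset.sum_add_distrib] at htot
  simp only [IcondMut, condHent, Hent_eq]
  linarith

end Entropy

section Tuples

theorem tup_eq_iff {Ω ι : Type} {𝒳 : ι → Type} (X : ∀ k, Ω → 𝒳 k) (S : Finset ι) (ω ω' : Ω) :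
    tup X S ω = tup X S ω' ↔ ∀ k ∈ S, X k ω = X k ω' := by
  simp [tup, funext_iff]

variable {Ω ι : Type} [Fintype Ω] [DecidableEq ι] {𝒳 : ι → Type} [∀ k, Fintype (𝒳 k)]
  {𝒱 : Type} [Fintype 𝒱]

theorem Hent_tup_pair (p : Ω → ℝ) (X : ∀ k, Ω → 𝒳 k) (S T : Finset ι) :
    Hent p (fun ω => (tup X S ω, tup X T ω)) = Hent p (tup X (S ∪ T)) :=
  Hent_congr p fun ω ω' => by
    simp only [Prod.mk.injEq, tup_eq_iff, Finset.mem_union, or_imp, forall_and]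

theorem IcondMut_tup (p : Ω → ℝ) (X : ∀ k, Ω → 𝒳 k) (V : Ω → 𝒱) (S C : Finset ι) :
    IcondMut p (tup X S) V (tup X C) =
      Hent p (tup X (S ∪ C)) + Hent p (fun ω => (V ω, tup X C ω)) - Hent p (tup X C)
        - Hent p (fun ω => (V ω, tup X (S ∪ C) ω)) := by
  have h : Hent p (fun ω => ((tup X S ω, V ω), tup X C ω)) =
      Hent p (fun ω => (V ω, tup X (S ∪ C) ω)) :=
    Hent_congr p fun ω ω' => by
      simp only [Prod.mk.injEq, tup_eq_iff, Finset.mem_union, or_imp, forall_and]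
      tauto
  rw [IcondMut, condHent, condHent, condHent, Hent_tup_pair, h]
  ring

theorem IcondMut_tup_empty (p : Ω → ℝ) (X : ∀ k, Ω → 𝒳 k) (V : Ω → 𝒱) (C : Finset ι) :
    IcondMut p (tup X ∅) V (tup X C) = 0 := by
  rw [IcondMut_tup, Finset.empty_union]
  ring

/-- Chain rule for mutual information. -/
theorem IcondMut_tup_union (p : Ω → ℝ) (X : ∀ k, Ω → 𝒳 k) (V : Ω → 𝒱) (S T C : Finset ι) :
    IcondMut p (tup X (S ∪ T)) V (tup X C) =
      IcondMut p (tup X T) V (tup X C) + IcondMut p (tup X S) V (tup X (T ∪ C)) := by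
  rw [IcondMut_tup, IcondMut_tup, IcondMut_tup, Finset.union_assoc]
  ring

theorem Hent_tup_submodular {p : Ω → ℝ} (hp : IsPMF p) (X : ∀ k, Ω → 𝒳 k) (V : Ω → 𝒱)
    (S T : Finset ι) :
    Hent p (fun ω => (V ω, tup X (S ∪ T) ω)) + Hent p (fun ω => (V ω, tup X (S ∩ T) ω)) ≤
      Hent p (fun ω => (V ω, tup X S ω)) + Hent p (fun ω => (V ω, tup X T ω)) := by
  have key := IcondMut_nonneg hp (tup X S) (tup X T) (fun ω => (V ω, tup X (S ∩ T) ω))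
  have hcap {U : Finset ι} (hU : S ∩ T ⊆ U) :
      Hent p (fun ω => (tup X U ω, (V ω, tup X (S ∩ T) ω))) =
        Hent p (fun ω => (V ω, tup X U ω)) :=
    Hent_congr p fun ω ω' => by
      simp only [Prod.mk.injEq, tup_eq_iff]
      exact ⟨fun h => ⟨h.2.1, h.1⟩, fun h => ⟨h.2, h.1, fun k hk => h.2 k (hU hk)⟩⟩
  have h : Hent p (fun ω => ((tup X S ω, tup X T ω), (V ω, tup X (S ∩ T) ω))) =
      Hent p (fun ω => (tup X (S ∪ T) ω, (V ω, tup X (S ∩ T) ω))) :=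
    Hent_congr p fun ω ω' => by
      simp only [Prod.mk.injEq, tup_eq_iff, Finset.mem_union, or_imp, forall_and]
  rw [IcondMut, condHent, condHent, condHent, h, hcap Finset.inter_subset_left,
    hcap Finset.inter_subset_right,
    hcap (Finset.inter_subset_left.trans Finset.subset_union_left)] at key
  linarith

theorem Hent_tup_le_add {p : Ω → ℝ} (hp : IsPMF p) (X : ∀ k, Ω → 𝒳 k) (S T : Finset ι) :
    Hent p (tup X (S ∪ T)) ≤ Hent p (tup X S) + Hent p (tup X T) := by
  have key := IcondMut_nonneg hp (tup X S) (tup X T) (tup X ∅)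
  have h0 : Hent p (tup X ∅) = 0 := by
    rw [Hent_eq]
    simp [probOf, tup_eq_iff, hp.2]
  have h1 (U : Finset ι) : Hent p (fun ω => (tup X U ω, tup X ∅ ω)) = Hent p (tup X U) :=
    Hent_congr p fun ω ω' => by simp [tup_eq_iff]
  have h2 : Hent p (fun ω => ((tup X S ω, tup X T ω), tup X ∅ ω)) = Hent p (tup X (S ∪ T)) :=
    Hent_congr p fun ω ω' => by
      simp [tup_eq_iff, or_imp, forall_and]
  rw [IcondMut, condHent, condHent, condHent, h1, h1, h2, h0] at key
  linarith

theorem Hent_tup_le_sum {p : Ω → ℝ} (hp : IsPMF p) (X : ∀ k, Ω → 𝒳 k) (S : Finset ι) :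
    Hent p (tup X S) ≤ ∑ k ∈ S, Hent p (X k) := by
  induction S using Finset.induction_on with
  | empty =>
    rw [Hent_eq]
    simp [probOf, tup_eq_iff, hp.2]
  | insert a S ha ih =>
    rw [Finset.sum_insert ha, Finset.insert_eq]
    have h : Hent p (tup X {a}) = Hent p (X a) :=
      Hent_congr p fun ω ω' => by simp [tup_eq_iff]
    linarith [Hent_tup_le_add hp X {a} S]

variable [Fintype ι]

theorem MutIndep.Hent_tup_univ {p : Ω → ℝ} (hp : IsPMF p) {X : ∀ k, Ω → 𝒳 k}
    (hind : MutIndep p X) : Hent p (tup X Finset.univ) = ∑ k, Hent p (X k) := by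
  have h : Hent p (tup X Finset.univ) = Hent p (fun ω k => X k ω) :=
    Hent_congr p fun ω ω' => by rw [tup_eq_iff, funext_iff]; simp
  rw [h]
  simp only [Hent_eq, Finset.sum_neg_distrib]
  rw [Finset.sum_comm]
  congr 1
  refine Finset.sum_congr rfl fun ω _ => ?_
  rw [← Finset.mul_sum]
  rcases (hp.1 ω).eq_or_lt with h0 | h0
  · simp [← h0]
  rw [hind, Real.log_prod fun k _ => (h0.trans_le (le_probOf hp.1 (X k) ω)).ne']

theorem MutIndep.Hent_tup {p : Ω → ℝ} (hp : IsPMF p) {X : ∀ k, Ω → 𝒳 k}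
    (hind : MutIndep p X) (S : Finset ι) : Hent p (tup X S) = ∑ k ∈ S, Hent p (X k) := by
  refine le_antisymm (Hent_tup_le_sum hp X S) ?_
  have h1 := Hent_tup_le_sum hp X Sᶜ
  have h2 := Hent_tup_le_add hp X S Sᶜ
  rw [Finset.union_compl, hind.Hent_tup_univ hp, ← Finset.sum_add_sum_compl S] at h2
  linarith

end Tuples

section Sandwich

variable {ι : Type} [DecidableEq ι]

/-- Submodularity of a set function on the subsets of `E`. -/
def SubmodularOn (E : Finset ι) (f : Finset ι → ℝ) : Prop :=
  ∀ S ⊆ E, ∀ T ⊆ E, f (S ∪ T) + f (S ∩ T) ≤ f S + f T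

/-- Supermodularity of a set function on the subsets of `E`. -/
def SupermodularOn (E : Finset ι) (g : Finset ι → ℝ) : Prop :=
  ∀ S ⊆ E, ∀ T ⊆ E, g S + g T ≤ g (S ∪ T) + g (S ∩ T)

/-- Frank's sandwich theorem: a modular function fits between a supermodular function and a
submodular function that dominates it. -/
theorem exists_modular_between (E : Finset ι) (f g : Finset ι → ℝ) (hf0 : f ∅ = 0) (hg0 : g ∅ = 0)
    (hf : SubmodularOn E f) (hg : SupermodularOn E g) (hgf : ∀ S ⊆ E, g S ≤ f S) :
    ∃ m : ι → ℝ, ∀ S ⊆ E, g S ≤ ∑ k ∈ S, m k ∧ ∑ k ∈ S, m k ≤ f S := by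
  induction E using Finset.induction_on generalizing f g with
  | empty =>
    refine ⟨0, fun S hS => ?_⟩
    simp [Finset.subset_empty.1 hS, hf0, hg0]
  | insert a E ha ih =>
    have hsub {S : Finset ι} (hS : S ⊆ E) : S ⊆ insert a E := hS.trans (Finset.subset_insert a E)
    have hins {S : Finset ι} (hS : S ⊆ E) : insert a S ⊆ insert a E :=
      Finset.insert_subset_insert a hS
    have hnot {S : Finset ι} (hS : S ⊆ E) : a ∉ S := fun h => ha (hS h)
    have hcross {S T : Finset ι} (hS : S ⊆ E) (hT : T ⊆ E) :
        g (insert a S) - f S ≤ f (insert a T) - g T := by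
      have h1 := hg _ (hins hS) _ (hsub hT)
      have h2 := hf _ (hsub hS) _ (hins hT)
      rw [Finset.insert_union, Finset.insert_inter_of_notMem (hnot hT)] at h1
      rw [Finset.union_insert, Finset.inter_insert_of_notMem (hnot hS)] at h2
      have := hgf _ (hins (Finset.union_subset hS hT))
      have := hgf _ (hsub (Finset.inter_subset_left.trans hS : S ∩ T ⊆ E))
      linarith
    obtain ⟨c, hc1, hc2⟩ : ∃ c, (∀ S ⊆ E, g (insert a S) - f S ≤ c) ∧
        ∀ T ⊆ E, c ≤ f (insert a T) - g T := by
      refine ⟨E.powerset.sup' ⟨∅, by simp⟩ fun S => g (insert a S) - f S, fun S hS => ?_,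
        fun T hT => ?_⟩
      · exact Finset.le_sup' (fun S => g (insert a S) - f S) (Finset.mem_powerset.2 hS)
      · exact Finset.sup'_le _ _ fun S hS => hcross (Finset.mem_powerset.1 hS) hT
    obtain ⟨m, hm⟩ := ih (fun S => min (f S) (f (insert a S) - c))
      (fun S => max (g S) (g (insert a S) - c))
      (by
        have := hc2 ∅ (Finset.empty_subset E)
        simp only [hf0]
        exact min_eq_left (by linarith))
      (by
        have := hc1 ∅ (Finset.empty_subset E)
        simp only [hg0]
        exact max_eq_left (by linarith))
      (fun S hS T hT => by
        have h1 := hf _ (hsub hS) _ (hsub hT)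
        have h2 := hf _ (hsub hS) _ (hins hT)
        have h3 := hf _ (hins hS) _ (hsub hT)
        have h4 := hf _ (hins hS) _ (hins hT)
        rw [Finset.union_insert, Finset.inter_insert_of_notMem (hnot hS)] at h2
        rw [Finset.insert_union, Finset.insert_inter_of_notMem (hnot hT)] at h3
        rw [← Finset.insert_union_distrib, ← Finset.insert_inter_distrib] at h4
        dsimp only
        grind)
      (fun S hS T hT => by
        have h1 := hg _ (hsub hS) _ (hsub hT)
        have h2 := hg _ (hsub hS) _ (hins hT)
        have h3 := hg _ (hins hS) _ (hsub hT)
        have h4 := hg _ (hins hS) _ (hins hT)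
        rw [Finset.union_insert, Finset.inter_insert_of_notMem (hnot hS)] at h2
        rw [Finset.insert_union, Finset.insert_inter_of_notMem (hnot hT)] at h3
        rw [← Finset.insert_union_distrib, ← Finset.insert_inter_distrib] at h4
        dsimp only
        grind)
      (fun S hS => by
        have h1 := hgf _ (hsub hS)
        have h2 := hgf _ (hins hS)
        have h3 := hc1 S hS
        have h4 := hc2 S hS
        refine max_le (le_min ?_ ?_) (le_min ?_ ?_) <;> linarith)
    refine ⟨Function.update m a c, fun S hS => ?_⟩
    have hupd {T : Finset ι} (hT : a ∉ T) :
        ∑ k ∈ T, Function.update m a c k = ∑ k ∈ T, m k :=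
      Finset.sum_congr rfl fun k hk =>
        Function.update_of_ne (fun h : k = a => hT (h ▸ hk)) _ _
    by_cases haS : a ∈ S
    · have hT : S.erase a ⊆ E := Finset.subset_insert_iff.1 hS
      obtain ⟨h1, h2⟩ := hm _ hT
      rw [Finset.insert_erase haS] at h1 h2
      rw [← Finset.add_sum_erase _ _ haS, hupd (Finset.notMem_erase a S), Function.update_self]
      have := (le_max_right _ _).trans h1
      have := h2.trans (min_le_right _ _)
      constructor <;> linarith
    · obtain ⟨h1, h2⟩ := hm S ((Finset.subset_insert_iff_of_notMem haS).1 hS)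
      rw [hupd haS]
      exact ⟨(le_max_left _ _).trans h1, h2.trans (min_le_left _ _)⟩

theorem exists_bases_le (E : Finset ι) (f g : Finset ι → ℝ) (hf0 : f ∅ = 0) (hg0 : g ∅ = 0)
    (hf : SubmodularOn E f) (hg : SupermodularOn E g) (hgf : ∀ S ⊆ E, g S ≤ f S) :
    ∃ r t : ι → ℝ, (∀ k ∈ E, r k ≤ t k) ∧ (∀ S ⊆ E, g S ≤ ∑ k ∈ S, r k) ∧
      (∀ S ⊆ E, ∑ k ∈ S, t k ≤ f S) ∧ ∑ k ∈ E, r k = g E ∧ ∑ k ∈ E, t k = f E := by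
  obtain ⟨m, hm⟩ := exists_modular_between E f g hf0 hg0 hf hg hgf
  have hEm := hm E subset_rfl
  have hmod (S T : Finset ι) : ∑ k ∈ S ∪ T, m k + ∑ k ∈ S ∩ T, m k = ∑ k ∈ S, m k + ∑ k ∈ T, m k :=
    Finset.sum_union_inter
  have hsplit {S T : Finset ι} (hS : S ⊆ E) (hT : T ⊆ E) (h : S ∩ T = E) : S = E ∧ T = E :=
    ⟨hS.antisymm (h ▸ Finset.inter_subset_left), hT.antisymm (h ▸ Finset.inter_subset_right)⟩
  obtain ⟨r, hr⟩ := exists_modular_between E (fun S => if S = E then g E else ∑ k ∈ S, m k) g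
    (by split_ifs with h; exacts [h ▸ hg0, Finset.sum_empty]) hg0
    (fun S hS T hT => by
      have := hmod S T
      have := @hsplit S T hS hT
      have h1 : S = E → S ∪ T = E ∧ S ∩ T = T := fun h => by subst h; simpa using hT
      have h2 : T = E → S ∪ T = E ∧ S ∩ T = S := fun h => by subst h; simpa using hS
      dsimp only
      grind) hg
    (fun S hS => by
      split_ifs with h
      · rw [h]
      · exact (hm S hS).1)
  obtain ⟨t, ht⟩ := exists_modular_between E f (fun S => if S = E then f E else ∑ k ∈ S, m k)
    hf0 (by split_ifs with h; exacts [h ▸ hf0, Finset.sum_empty]) hf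
    (fun S hS T hT => by
      have := hmod S T
      have := @hsplit S T hS hT
      have h1 : S = E → S ∪ T = E ∧ S ∩ T = T := fun h => by subst h; simpa using hT
      have h2 : T = E → S ∪ T = E ∧ S ∩ T = S := fun h => by subst h; simpa using hS
      dsimp only
      grind)
    (fun S hS => by
      split_ifs with h
      · rw [h]
      · exact (hm S hS).2)
  refine ⟨r, t, fun k hk => ?_, fun S hS => (hr S hS).1, fun S hS => (ht S hS).2,
    le_antisymm ?_ (hr E subset_rfl).1, le_antisymm (ht E subset_rfl).2 ?_⟩
  · have h1 := (hr {k} (by simpa using hk)).2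
    have h2 := (ht {k} (by simpa using hk)).1
    by_cases h : {k} = E
    · have := hgf E subset_rfl
      rw [if_pos h, Finset.sum_singleton] at h1 h2
      linarith
    · rw [if_neg h, Finset.sum_singleton, Finset.sum_singleton] at h1 h2
      linarith
  · simpa using (hr E subset_rfl).2
  · simpa using (ht E subset_rfl).1

end Sandwich

section Region

variable {Ω ι : Type} [Fintype Ω] [Fintype ι] [DecidableEq ι] {𝒳 : ι → Type}
  [∀ k, Fintype (𝒳 k)] {𝒱 : Type} [Fintype 𝒱] {p : Ω → ℝ} {X : ∀ k, Ω → 𝒳 k}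

theorem MutIndep.IcondMut_compl_submodular (hp : IsPMF p) (hind : MutIndep p X) (V : Ω → 𝒱)
    (E : Finset ι) :
    SubmodularOn E fun S => IcondMut p (tup X S) V (tup X (Finset.univ \ S)) := by
  intro S _ T _
  have h := Hent_tup_submodular hp X V (Finset.univ \ S) (Finset.univ \ T)
  have hmod := Finset.sum_union_inter (s₁ := Finset.univ \ S) (s₂ := Finset.univ \ T)
    (f := fun k => Hent p (X k))
  rw [← Finset.sdiff_inter_distrib_right, ← Finset.sdiff_union_distrib] at h hmod
  have huniv (U : Finset ι) : IcondMut p (tup X U) V (tup X (Finset.univ \ U)) =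
      ∑ k, Hent p (X k) + Hent p (fun ω => (V ω, tup X (Finset.univ \ U) ω))
        - ∑ k ∈ Finset.univ \ U, Hent p (X k)
        - Hent p (fun ω => (V ω, tup X Finset.univ ω)) := by
    rw [IcondMut_tup, Finset.union_sdiff_of_subset (Finset.subset_univ U), hind.Hent_tup hp,
      hind.Hent_tup hp]
  simp only [huniv]
  linarith

theorem MutIndep.IcondMut_supermodular (hp : IsPMF p) (hind : MutIndep p X) (V : Ω → 𝒱)
    (E C : Finset ι) :
    SupermodularOn E fun S => IcondMut p (tup X S) V (tup X C) := by
  intro S _ T _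
  have h := Hent_tup_submodular hp X V (S ∪ C) (T ∪ C)
  have hmod := Finset.sum_union_inter (s₁ := S ∪ C) (s₂ := T ∪ C)
    (f := fun k => Hent p (X k))
  rw [← Finset.union_union_distrib_right, ← Finset.inter_union_distrib_right] at h hmod
  simp only [IcondMut_tup, hind.Hent_tup hp]
  linarith

theorem IcondMut_compl_le_union (hp : IsPMF p) (X : ∀ k, Ω → 𝒳 k) (V : Ω → 𝒱)
    {S T : Finset ι} (hST : Disjoint S T) :
    IcondMut p (tup X S) V (tup X (Finset.univ \ S)) ≤
      IcondMut p (tup X (S ∪ T)) V (tup X (Finset.univ \ (S ∪ T))) := by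
  have h : T ∪ Finset.univ \ (S ∪ T) = Finset.univ \ S := by
    ext k
    have h (hk : k ∈ S) : k ∉ T := Finset.disjoint_left.1 hST hk
    simp
    tauto
  rw [IcondMut_tup_union, h]
  linarith [IcondMut_nonneg hp (tup X T) V (tup X (Finset.univ \ (S ∪ T)))]

end Region

theorem stmt7 {K : ℕ} (hK : 1 ≤ K) {Ω : Type} [Fintype Ω]
    {𝒳 : Fin K → Type} [∀ k, Fintype (𝒳 k)] {𝒴 𝒵 : Type} [Fintype 𝒴] [Fintype 𝒵]
    (p : Ω → ℝ) (hp : IsPMF p)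
    (X : ∀ k, Ω → 𝒳 k) (Y : Ω → 𝒴) (Z : Ω → 𝒵) (hind : MutIndep p X) :
    IsGreatest
      {r : ℝ | ∃ (K' : Finset (Fin K)) (Rs Ro : Fin K → ℝ),
        InRegion p X Y Z K' Rs Ro ∧ r = ∑ k, Rs k}
      (Finset.univ.sup' Finset.univ_nonempty (fun K' : Finset (Fin K) =>
        max 0 (IcondMut p (tup X K') Y (tup X (Finset.univ \ K')) -
               IcondMut p (tup X K') Z (tup X (Finset.univ \ K'))))) := by

  have hval (K' : Finset (Fin K)) (Rs : Fin K → ℝ) (h : ∀ k ∈ Finset.univ \ K', Rs k = 0) :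
      ∑ k, Rs k = ∑ k ∈ K', Rs k :=
    (Finset.sum_subset (Finset.subset_univ K') fun k _ hk => h k (by simp [hk])).symm
  constructor
  · obtain ⟨E, -, hE⟩ := Finset.exists_mem_eq_sup' Finset.univ_nonempty
      (fun K' : Finset (Fin K) =>
        max 0 (IcondMut p (tup X K') Y (tup X (Finset.univ \ K')) -
               IcondMut p (tup X K') Z (tup X (Finset.univ \ K'))))
    have hmax (K' : Finset (Fin K)) := hE ▸ Finset.le_sup' (fun K' : Finset (Fin K) =>
        max 0 (IcondMut p (tup X K') Y (tup X (Finset.univ \ K')) -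
               IcondMut p (tup X K') Z (tup X (Finset.univ \ K')))) (Finset.mem_univ K')
    rw [hE]
    rcases le_or_gt (IcondMut p (tup X E) Y (tup X (Finset.univ \ E)) -
               IcondMut p (tup X E) Z (tup X (Finset.univ \ E))) 0 with h0 | h0
    · exact ⟨E, 0, 0, ⟨by simp, by simp, by simp, by simp⟩, by simp [h0]⟩
    set f : Finset (Fin K) → ℝ := fun S => IcondMut p (tup X S) Y (tup X (Finset.univ \ S)) with hf
    set g : Finset (Fin K) → ℝ := fun S => IcondMut p (tup X S) Z (tup X (Finset.univ \ E)) with hg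
    have hfsub := hind.IcondMut_compl_submodular hp Y
    have hgf (S : Finset (Fin K)) (hS : S ⊆ E) : g S ≤ f S := by
      have h1 := (le_max_right _ _).trans (hmax (E \ S))
      rw [max_eq_right h0.le] at h1
      have h2 := hfsub E S hS (E \ S) Finset.sdiff_subset
      have h3 := IcondMut_tup_union p X Z (E \ S) S (Finset.univ \ E)
      have h4 : S ∪ Finset.univ \ E = Finset.univ \ (E \ S) := by
        ext k
        have := @hS k
        simp
        tauto
      dsimp only at h2
      rw [Finset.union_sdiff_of_subset hS, Finset.inter_sdiff_self, IcondMut_tup_empty] at h2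
      rw [Finset.sdiff_union_of_subset hS, h4] at h3
      simp only [hf, hg]
      linarith
    obtain ⟨r, t, hrt, hgr, htf, hrE, htE⟩ := exists_bases_le E f g
      (IcondMut_tup_empty p X Y _) (IcondMut_tup_empty p X Z _) (hfsub E)
      (hind.IcondMut_supermodular hp Z E _) hgf
    have hzero {S : Finset (Fin K)} (hS : S ⊆ E) (u : Fin K → ℝ) :
        ∑ k ∈ S, (if k ∈ E then u k else 0) = ∑ k ∈ S, u k :=
      Finset.sum_congr rfl fun k hk => if_pos (hS hk)
    refine ⟨E, fun k => if k ∈ E then t k - r k else 0, fun k => if k ∈ E then r k else 0,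
      ⟨fun k => ?_, fun k => ?_, fun k hk => if_neg (by simpa using hk),
        fun S hS S' hS' T hT => ?_⟩, ?_⟩
    · dsimp only
      split_ifs with hk
      · exact sub_nonneg.2 (hrt k hk)
      · exact le_rfl
    · dsimp only
      split_ifs with hk
      · have := hgr {k} (by simpa using hk)
        rw [Finset.sum_singleton] at this
        exact (IcondMut_nonneg hp _ _ _).trans this
      · exact le_rfl
    · have hT0 : ∑ k ∈ T, (if k ∈ E then r k else 0) = 0 :=
        Finset.sum_eq_zero fun k hk => if_neg (Finset.mem_sdiff.1 (hT hk)).2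
      have hdisj : Disjoint S T :=
        Finset.disjoint_of_subset_right hT (Finset.disjoint_of_subset_left hS Finset.disjoint_sdiff)
      have h1 := IcondMut_compl_le_union hp X Y hdisj
      have h2 := htf S hS
      have h3 := hgr S' (hS'.trans hS)
      have h4 := Finset.sum_sdiff hS' (f := r)
      refine le_max_of_le_right ?_
      rw [hzero hS, hzero (Finset.sdiff_subset.trans hS), hT0, Finset.sum_sub_distrib]
      simp only [hf, hg] at h2 h3
      linarith
    · rw [hval E _ fun k hk => if_neg (by simpa using hk), hzero subset_rfl,
        Finset.sum_sub_distrib, htE, hrE, max_eq_right h0.le]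
  · rintro _ ⟨K', Rs, Ro, ⟨-, -, hRs, hR⟩, rfl⟩
    have h := hR K' subset_rfl K' subset_rfl ∅ (Finset.empty_subset _)
    rw [Finset.sdiff_self, Finset.sum_empty, add_zero, add_zero,
      Finset.union_empty] at h
    rw [hval K' Rs hRs]
    exact h.trans (Finset.le_sup' (fun K' : Finset (Fin K) =>
        max 0 (IcondMut p (tup X K') Y (tup X (Finset.univ \ K')) -
               IcondMut p (tup X K') Z (tup X (Finset.univ \ K')))) (Finset.mem_univ K'))
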